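/- For every integer d ≥ 1, the constants C_{H,h} := c^d_{H,h} √(Γ(H)Γ(h)) (H+h), defined for H,h ∈ (0,1/2), satisfy lim_{H̄↓0} sup_{0<h,H<H̄} |C_{h,H} − 1| = 0. -/

import Mathlib

open Real in
/-- The covariance constant `c^d_{H,h}` of the well-balanced fractional Brownian fields. -/
noncomputable def cConst (d : ℕ) (H h : ℝ) : ℝ :=
  Real.Gamma ((H + h + 1) / 2) *
    Real.sqrt (Real.Gamma ((H + d) / 2) * H * Real.Gamma (2 * H) * Real.sin (π * H) *
      Real.Gamma ((h + d) / 2) * h * Real.Gamma (2 * h) * Real.sin (π * h)) /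
  (Real.Gamma ((H + h + d) / 2) * (H + h) * Real.Gamma (H + h) *
    Real.sin ((H + h) * π / 2) *
    Real.sqrt (Real.Gamma (H + 1 / 2) * Real.Gamma (h + 1 / 2)))

/-- The continuous function of two variables that extends the normalised covariance constant
through the origin. -/
noncomputable def normalizedConst (d : ℕ) (p : ℝ × ℝ) : ℝ :=
  Real.Gamma ((p.1 + p.2 + 1) / 2) *
    Real.sqrt ((Real.Gamma ((p.1 + d) / 2) * Real.Gamma (2 * p.1 + 1) *
        Real.sinc (Real.pi * p.1) * Real.Gamma (p.1 + 1)) *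
      (Real.Gamma ((p.2 + d) / 2) * Real.Gamma (2 * p.2 + 1) *
        Real.sinc (Real.pi * p.2) * Real.Gamma (p.2 + 1))) /
  (Real.Gamma ((p.1 + p.2 + d) / 2) * Real.Gamma (p.1 + p.2 + 1) *
    Real.sinc ((p.1 + p.2) * Real.pi / 2) *
    Real.sqrt (Real.Gamma (p.1 + 1 / 2) * Real.Gamma (p.2 + 1 / 2)))

theorem continuousAt_Gamma_comp {X : Type*} [TopologicalSpace X] {f : X → ℝ} {x : X}
    (hf : ContinuousAt f x) (hx : 0 < f x) : ContinuousAt (fun y => Real.Gamma (f y)) x := by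
  have hG : ContinuousAt Real.Gamma (f x) :=
    (Real.differentiableAt_Gamma fun m => by
      have : (0 : ℝ) ≤ m := m.cast_nonneg
      linarith).continuousAt
  exact ContinuousAt.comp (f := f) hG hf

theorem normalizedConst_zero {d : ℕ} (hd : 1 ≤ d) : normalizedConst d (0, 0) = 1 := by
  have hd' : (0 : ℝ) < d := by exact_mod_cast hd
  have h1 : 0 < Real.Gamma ((d : ℝ) / 2) := Real.Gamma_pos_of_pos (by positivity)
  have h2 : 0 < Real.Gamma (1 / 2 : ℝ) := Real.Gamma_pos_of_pos (by positivity)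
  simp only [normalizedConst, zero_add, mul_zero, zero_mul, zero_div, Real.sinc_zero,
    Real.Gamma_one, mul_one, Real.sqrt_mul_self h1.le, Real.sqrt_mul_self h2.le]
  field_simp

theorem continuousAt_normalizedConst {d : ℕ} (hd : 1 ≤ d) :
    ContinuousAt (normalizedConst d) (0, 0) := by
  have hd' : (0 : ℝ) < d := by exact_mod_cast hd
  have h1 : 0 < Real.Gamma ((d : ℝ) / 2) := Real.Gamma_pos_of_pos (by positivity)
  have h2 : 0 < Real.Gamma (1 / 2 : ℝ) := Real.Gamma_pos_of_pos (by positivity)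
  have hs : ∀ {f : ℝ × ℝ → ℝ}, Continuous f →
      ContinuousAt (fun p => Real.sinc (f p)) (0, 0) :=
    fun hf => (Real.continuous_sinc.comp hf).continuousAt
  have hG : ∀ {f : ℝ × ℝ → ℝ}, Continuous f → 0 < f (0, 0) →
      ContinuousAt (fun p => Real.Gamma (f p)) (0, 0) :=
    fun hf h0 => continuousAt_Gamma_comp hf.continuousAt h0
  unfold normalizedConst
  refine ContinuousAt.div (ContinuousAt.mul (hG (by fun_prop) (by norm_num))
    (ContinuousAt.sqrt (ContinuousAt.mul ?_ ?_))) (ContinuousAt.mul ?_ (ContinuousAt.sqrt ?_)) ?_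
  · exact (((hG (by fun_prop) (by simpa using hd')).mul (hG (by fun_prop) (by norm_num))).mul
      (hs (by fun_prop))).mul (hG (by fun_prop) (by norm_num))
  · exact (((hG (by fun_prop) (by simpa using hd')).mul (hG (by fun_prop) (by norm_num))).mul
      (hs (by fun_prop))).mul (hG (by fun_prop) (by norm_num))
  · exact ((hG (by fun_prop) (by simpa using hd')).mul (hG (by fun_prop) (by norm_num))).mul
      (hs (by fun_prop))
  · exact (hG (by fun_prop) (by norm_num)).mul (hG (by fun_prop) (by norm_num))
  · simp only [zero_add, zero_mul, zero_div, Real.sinc_zero, Real.Gamma_one, mul_one,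
      Real.sqrt_mul_self h2.le]
    positivity

theorem cConst_mul_eq_normalizedConst (d : ℕ) {x y : ℝ} (hx : x ∈ Set.Ioo (0 : ℝ) (1 / 2))
    (hy : y ∈ Set.Ioo (0 : ℝ) (1 / 2)) :
    cConst d x y * Real.sqrt (Real.Gamma x * Real.Gamma y) * (x + y) =
      normalizedConst d (x, y) := by
  obtain ⟨hx0, hx1⟩ := hx
  obtain ⟨hy0, hy1⟩ := hy
  have hpi := Real.pi_pos
  have hxy : 0 < x + y := add_pos hx0 hy0
  have hgx := Real.Gamma_pos_of_pos hx0
  have hgy := Real.Gamma_pos_of_pos hy0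
  have hsqrt : Real.sqrt (Real.Gamma ((x + d) / 2) * x * Real.Gamma (2 * x) *
        Real.sin (Real.pi * x) * Real.Gamma ((y + d) / 2) * y * Real.Gamma (2 * y) *
        Real.sin (Real.pi * y)) * Real.sqrt (Real.Gamma x * Real.Gamma y) =
      Real.pi / 2 * Real.sqrt ((Real.Gamma ((x + d) / 2) * Real.Gamma (2 * x + 1) *
        Real.sinc (Real.pi * x) * Real.Gamma (x + 1)) *
      (Real.Gamma ((y + d) / 2) * Real.Gamma (2 * y + 1) *
        Real.sinc (Real.pi * y) * Real.Gamma (y + 1))) := by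
    rw [← Real.sqrt_mul' _ (by positivity),
      ← Real.sqrt_sq (show (0 : ℝ) ≤ Real.pi / 2 by positivity),
      ← Real.sqrt_mul (by positivity)]
    congr 1
    rw [Real.sinc_of_ne_zero (by positivity), Real.sinc_of_ne_zero (by positivity),
      Real.Gamma_add_one hx0.ne', Real.Gamma_add_one hy0.ne',
      Real.Gamma_add_one (by positivity), Real.Gamma_add_one (by positivity)]
    field_simp
  have hsin : 0 < Real.sin ((x + y) * Real.pi / 2) :=
    Real.sin_pos_of_pos_of_lt_pi (by positivity) (by nlinarith)
  have hG1 : 0 < Real.Gamma ((x + y + d) / 2) := Real.Gamma_pos_of_pos (by positivity)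
  have hG2 : 0 < Real.Gamma (x + y) := Real.Gamma_pos_of_pos hxy
  have hG3 : 0 < Real.Gamma (x + 1 / 2) := Real.Gamma_pos_of_pos (by positivity)
  have hG4 : 0 < Real.Gamma (y + 1 / 2) := Real.Gamma_pos_of_pos (by positivity)
  have hS : 0 < Real.sqrt (Real.Gamma (x + 1 / 2) * Real.Gamma (y + 1 / 2)) := by positivity
  simp only [cConst, normalizedConst]
  rw [div_mul_eq_mul_div, mul_assoc (Real.Gamma ((x + y + 1) / 2)), hsqrt,
    Real.Gamma_add_one hxy.ne',
    Real.sinc_of_ne_zero (show (x + y) * Real.pi / 2 ≠ 0 by positivity)]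
  generalize Real.sqrt (Real.Gamma (x + 1 / 2) * Real.Gamma (y + 1 / 2)) = S at *
  generalize Real.sin ((x + y) * Real.pi / 2) = s at *
  generalize Real.sqrt _ = T
  field_simp

theorem stmt_16 (d : ℕ) (hd : 1 ≤ d) :
    ∀ ε > (0 : ℝ), ∃ Hb ∈ Set.Ioo (0 : ℝ) (1 / 2),
      ∀ H h : ℝ, H ∈ Set.Ioo (0 : ℝ) Hb → h ∈ Set.Ioo (0 : ℝ) Hb →
        |cConst d h H * Real.sqrt (Real.Gamma h * Real.Gamma H) * (h + H) - 1| ≤ ε := by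
  intro ε hε
  obtain ⟨δ, hδ, hball⟩ := Metric.continuousAt_iff.1 (continuousAt_normalizedConst hd) ε hε
  refine ⟨min δ (1 / 4), ⟨by positivity, (min_le_right _ _).trans_lt (by norm_num)⟩, ?_⟩
  intro H h ⟨hH0, hH1⟩ ⟨hh0, hh1⟩
  obtain ⟨hH2, hH3⟩ := lt_min_iff.1 hH1
  obtain ⟨hh2, hh3⟩ := lt_min_iff.1 hh1
  rw [cConst_mul_eq_normalizedConst d ⟨hh0, by linarith⟩ ⟨hH0, by linarith⟩]
  have hdist : dist (h, H) ((0, 0) : ℝ × ℝ) < δ := by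
    simp [Prod.dist_eq, abs_of_pos hh0, abs_of_pos hH0, hh2, hH2]
  have := hball hdist
  rw [normalizedConst_zero hd, Real.dist_eq] at this
  exact this.le
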